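/- arXiv:1806.10208 — 2 statements merged into one kernel-verified Lean document; each statement's English description precedes it below -/
import Mathlib

section
/- Let n ≥ 1, let f : ℝⁿ → ℝⁿ be a C∞ map and μ : ℝⁿ → ℝ a C∞ function. Write J(x) = det(Df(x)), let A(x) be the adjugate (cofactor transpose) matrix of the Jacobian matrix Df(x), and set w(x) = J(x)·∇μ(x) + 2μ(x)·∇J(x) ∈ ℝⁿ. Define F : ℝⁿ → ℝⁿ × ℝ by F(x) = (f(x), μ(x)J(x)²) and φ : ℝⁿ → ℝⁿ × ℝ by φ(x) = (A(x)ᵀ·w(x), −1). Then φ is C∞, φ(x) ≠ 0 for all x, and for every x ∈ ℝⁿ and every v ∈ ℝⁿ the Euclidean inner product ⟨φ(x), DF(x)v⟩ equals 0. -/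
open scoped ContDiff

theorem ContDiff.matrix_det {E ι : Type*} [NormedAddCommGroup E] [NormedSpace ℝ E] [Fintype ι]
    [DecidableEq ι] {k : WithTop ℕ∞} {M : E → Matrix ι ι ℝ}
    (hM : ∀ i j, ContDiff ℝ k fun x => M x i j) : ContDiff ℝ k fun x => (M x).det := by
  simp only [Matrix.det_apply']
  exact ContDiff.sum fun σ _ => contDiff_const.mul (contDiff_prod fun i _ => hM _ _)

theorem ContDiff.matrix_adjugate_apply {E ι : Type*} [NormedAddCommGroup E] [NormedSpace ℝ E]
    [Fintype ι] [DecidableEq ι] {k : WithTop ℕ∞} {M : E → Matrix ι ι ℝ}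
    (hM : ∀ i j, ContDiff ℝ k fun x => M x i j) (i j : ι) :
    ContDiff ℝ k fun x => (M x).adjugate i j := by
  simp only [Matrix.adjugate_apply]
  refine ContDiff.matrix_det fun a b => ?_
  by_cases h : a = j
  · simp only [Matrix.updateRow_apply, h, if_true]
    exact contDiff_const
  · simpa only [Matrix.updateRow_apply, h, if_false] using hM a b

theorem ContDiff.fderiv_apply_const {E G : Type*} [NormedAddCommGroup E] [NormedSpace ℝ E]
    [NormedAddCommGroup G] [NormedSpace ℝ G] {g : E → G} (hg : ContDiff ℝ ∞ g) (v : E) :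
    ContDiff ℝ ∞ fun x => fderiv ℝ g x v :=
  (hg.fderiv_right (m := ∞) le_rfl).clm_apply contDiff_const

theorem ContinuousLinearMap.apply_eq_dotProduct_single {ι : Type*} [Fintype ι] [DecidableEq ι]
    (L : (ι → ℝ) →L[ℝ] ℝ) (v : ι → ℝ) :
    L v = (fun j => L (Pi.single j 1)) ⬝ᵥ v := by
  conv_lhs => rw [pi_eq_sum_univ' v, map_sum]
  simp only [map_smul, smul_eq_mul, dotProduct]
  exact Finset.sum_congr rfl fun j _ => mul_comm _ _

/-- For a C∞ map `f : ℝⁿ → ℝⁿ` and a C∞ function `μ`, with `J = det Df`,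
`A` the adjugate of the Jacobian matrix, `w = J∇μ + 2μ∇J`, `F = (f, μJ²)` and
`φ = (Aᵀw, −1)`, the map `φ` is C∞, nowhere zero, and `⟨φ(x), DF(x)v⟩ = 0` always. -/
theorem frontal_normal_field (n : ℕ) (hn : 1 ≤ n)
    (f : (Fin n → ℝ) → (Fin n → ℝ)) (hf : ContDiff ℝ ∞ f)
    (μ : (Fin n → ℝ) → ℝ) (hμ : ContDiff ℝ ∞ μ)
    (Df : (Fin n → ℝ) → Matrix (Fin n) (Fin n) ℝ)
    (hDf : ∀ x, Df x = Matrix.of fun i j => fderiv ℝ (fun y => f y i) x (Pi.single j 1))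
    (J : (Fin n → ℝ) → ℝ) (hJ : ∀ x, J x = (Df x).det)
    (A : (Fin n → ℝ) → Matrix (Fin n) (Fin n) ℝ) (hA : ∀ x, A x = (Df x).adjugate)
    (w : (Fin n → ℝ) → (Fin n → ℝ))
    (hw : ∀ x, w x = (J x • fun j => fderiv ℝ μ x (Pi.single j 1))
        + ((2 * μ x) • fun j => fderiv ℝ J x (Pi.single j 1)))
    (F : (Fin n → ℝ) → (Fin n → ℝ) × ℝ) (hF : ∀ x, F x = (f x, μ x * (J x) ^ 2))
    (φ : (Fin n → ℝ) → (Fin n → ℝ) × ℝ)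
    (hφ : ∀ x, φ x = ((A x).transpose.mulVec (w x), -1)) :
    ContDiff ℝ ∞ φ ∧ (∀ x, φ x ≠ 0) ∧
      ∀ x, ∀ v : Fin n → ℝ,
        (∑ j, (φ x).1 j * (fderiv ℝ F x v).1 j) + (φ x).2 * (fderiv ℝ F x v).2 = 0 := by
  have hf_apply : ∀ i, ContDiff ℝ ∞ fun y => f y i := contDiff_pi.1 hf
  have hDf_smooth : ∀ i j, ContDiff ℝ ∞ fun x => Df x i j := fun i j => by
    simp only [hDf, Matrix.of_apply]
    exact (hf_apply i).fderiv_apply_const _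
  have hJ_smooth : ContDiff ℝ ∞ J := by
    rw [funext hJ]
    exact ContDiff.matrix_det hDf_smooth
  have hw_smooth : ∀ i, ContDiff ℝ ∞ fun x => w x i := fun i => by
    simp only [hw, Pi.add_apply, Pi.smul_apply, smul_eq_mul]
    exact (hJ_smooth.mul (hμ.fderiv_apply_const _)).add
      ((contDiff_const.mul hμ).mul (hJ_smooth.fderiv_apply_const _))
  refine ⟨?_, fun x h => ?_, fun x v => ?_⟩
  · rw [funext hφ]
    refine ContDiff.prodMk (contDiff_pi.2 fun i => ?_) contDiff_const
    simp only [Matrix.mulVec, dotProduct, Matrix.transpose_apply, hA]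
    exact ContDiff.sum fun j _ =>
      (ContDiff.matrix_adjugate_apply hDf_smooth j i).mul (hw_smooth j)
  · have h2 := congrArg Prod.snd h
    simp [hφ] at h2
  · have hne : (∞ : WithTop ℕ∞) ≠ 0 := by simp
    have hf_diff := (hf.differentiable hne x).hasFDerivAt
    have hμ_diff := (hμ.differentiable hne x).hasFDerivAt
    have hJ_diff := (hJ_smooth.differentiable hne x).hasFDerivAt
    have hF_diff := hf_diff.prodMk (hμ_diff.mul (hJ_diff.pow 2))
    have hF_eq : F = fun y => (f y, (μ * J ^ 2) y) := funext hF
    have hF_fderiv := hF_eq ▸ hF_diff.fderiv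
    have hf_mulVec : fderiv ℝ f x v = (Df x).mulVec v := by
      ext i
      have hi : fderiv ℝ f x v i = fderiv ℝ (fun y => f y i) x v := by
        rw [((hasFDerivAt_pi'.1 hf_diff) i).fderiv]
        rfl
      rw [hi, ContinuousLinearMap.apply_eq_dotProduct_single, hDf]
      rfl
    have hw_dot : w x ⬝ᵥ v = J x * fderiv ℝ μ x v + 2 * μ x * fderiv ℝ J x v := by
      rw [hw, add_dotProduct, smul_dotProduct, smul_dotProduct,
        ← ContinuousLinearMap.apply_eq_dotProduct_single,
        ← ContinuousLinearMap.apply_eq_dotProduct_single, smul_eq_mul, smul_eq_mul]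
    have hmain : (A x).transpose.mulVec (w x) ⬝ᵥ (Df x).mulVec v = J x * (w x ⬝ᵥ v) := by
      rw [Matrix.mulVec_transpose, ← Matrix.dotProduct_mulVec, Matrix.mulVec_mulVec, hA,
        Matrix.adjugate_mul, Matrix.smul_mulVec, Matrix.one_mulVec, dotProduct_smul, hJ,
        smul_eq_mul]
    have hfst : (fderiv ℝ F x v).1 = (Df x).mulVec v := by
      rw [hF_fderiv, ← hf_mulVec]
      rfl
    have hsnd : (fderiv ℝ F x v).2
        = μ x * (2 * J x * fderiv ℝ J x v) + J x ^ 2 * fderiv ℝ μ x v := by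
      rw [hF_fderiv]
      simp
    rw [hfst, hsnd, hφ]
    change (A x).transpose.mulVec (w x) ⬝ᵥ (Df x).mulVec v + _ = 0
    rw [hmain, hw_dot]
    ring
end

section
/- Let g : ℝ → ℝ be given by g(x) = x³/3, and let φ : ℝ → ℝ be a C∞ function such that there exist a neighborhood U of 0 and a C∞ function a : ℝ → ℝ with φ'(x) = a(x)·x² for all x ∈ U. Then there exist a neighborhood V of 0 and C∞ functions μ : ℝ → ℝ and η : ℝ → ℝ such that φ(x) = μ(x)·x⁴ + η(x³/3) for all x ∈ V. (This is the case n = 1, dim Q(f) = 3 of the equality ⟨|Jf|²⟩_{E_n} + f*(E_n) = R_f, since |Jg|(x)² = x⁴.) -/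
open scoped ContDiff

/-- Differentiation under the integral sign for the moments `∫₀¹ tᵏ c(tx) dt`. -/
theorem hasDerivAt_integral_pow_mul_comp_mul {c : ℝ → ℝ} (hc : ContDiff ℝ 1 c) (k : ℕ) (x : ℝ) :
    HasDerivAt (fun x => ∫ t in (0 : ℝ)..1, t ^ k * c (t * x))
      (∫ t in (0 : ℝ)..1, t ^ (k + 1) * deriv c (t * x)) x := by
  have hc0 : Continuous c := hc.continuous
  have hc1 : Continuous (deriv c) := hc.continuous_deriv le_rfl
  have hcont : Continuous fun p : ℝ × ℝ => p.1 ^ (k + 1) * deriv c (p.1 * p.2) := by fun_prop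
  obtain ⟨C, hC⟩ := ((isCompact_Icc (a := (0 : ℝ)) (b := 1)).prod
    (isCompact_closedBall x 1)).exists_bound_of_continuousOn hcont.continuousOn
  refine (intervalIntegral.hasDerivAt_integral_of_dominated_loc_of_deriv_le
    (F := fun x t => t ^ k * c (t * x)) (F' := fun x t => t ^ (k + 1) * deriv c (t * x))
    (bound := fun _ => C) (Metric.ball_mem_nhds x one_pos) ?_ ?_ ?_ ?_ ?_ ?_).2
  · exact .of_forall fun y => Continuous.aestronglyMeasurable (by fun_prop)
  · exact Continuous.intervalIntegrable (by fun_prop) _ _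
  · exact Continuous.aestronglyMeasurable (by fun_prop)
  · refine .of_forall fun t ht y hy => hC (t, y) ⟨?_, Metric.ball_subset_closedBall hy⟩
    rw [Set.uIoc_of_le zero_le_one] at ht
    exact Set.Ioc_subset_Icc_self ht
  · exact intervalIntegrable_const
  · refine .of_forall fun t _ y _ => ?_
    have hd := ((hc.differentiable one_ne_zero (t * y)).hasDerivAt.comp y
      ((hasDerivAt_id y).const_mul t)).const_mul (t ^ k)
    refine hd.congr_deriv ?_
    ring

theorem contDiff_integral_pow_mul_comp_mul {c : ℝ → ℝ} (hc : ContDiff ℝ ∞ c) (k : ℕ) :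
    ContDiff ℝ ∞ (fun x => ∫ t in (0 : ℝ)..1, t ^ k * c (t * x)) := by
  rw [contDiff_infty]
  intro n
  induction n generalizing c k with
  | zero =>
    exact contDiff_zero.2 <| continuous_iff_continuousAt.2 fun x =>
      (hasDerivAt_integral_pow_mul_comp_mul (hc.of_le (by simp)) k x).continuousAt
  | succ n ih =>
    have hderiv := hasDerivAt_integral_pow_mul_comp_mul (hc.of_le (by simp)) k
    rw [Nat.cast_succ, contDiff_succ_iff_deriv]
    refine ⟨fun x => (hderiv x).differentiableAt, by simp, ?_⟩
    rw [funext fun x => (hderiv x).deriv]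
    exact ih (contDiff_infty_iff_deriv.1 hc).2 (k + 1)

/-- Hadamard's lemma with a derivative vanishing to order `k` at the origin. -/
theorem eq_add_pow_mul_integral_of_hasDerivAt {f c : ℝ → ℝ} {k : ℕ} {r x : ℝ}
    (hc : Continuous c) (hf : ∀ y ∈ Metric.ball (0 : ℝ) r, HasDerivAt f (y ^ k * c y) y)
    (hx : x ∈ Metric.ball (0 : ℝ) r) :
    f x = f 0 + x ^ (k + 1) * ∫ t in (0 : ℝ)..1, t ^ k * c (t * x) := by
  have hftc := intervalIntegral.integral_eq_sub_of_hasDerivAt (a := 0) (b := 1)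
    (f := fun t => f (t * x)) (f' := fun t => x ^ (k + 1) * (t ^ k * c (t * x))) ?_
    (Continuous.intervalIntegrable (by fun_prop) _ _)
  · rw [intervalIntegral.integral_const_mul] at hftc
    simp only [one_mul, zero_mul] at hftc
    linarith
  · intro t ht
    rw [Set.uIcc_of_le zero_le_one] at ht
    have hmem : t * x ∈ Metric.ball (0 : ℝ) r := by
      rw [mem_ball_zero_iff] at hx ⊢
      rw [norm_mul, Real.norm_of_nonneg ht.1]
      exact (mul_le_of_le_one_left (norm_nonneg x) ht.2).trans_lt hx
    have hd := (hf _ hmem).comp t ((hasDerivAt_id t).mul_const x)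
    refine hd.congr_deriv ?_
    ring

/-- If `φ : ℝ → ℝ` is C∞ and `φ'(x) = a(x)·x²` near `0` for some C∞ `a`,
then near `0` one can write `φ(x) = μ(x)x⁴ + η(x³/3)` with `μ, η` C∞.
(Case `n = 1`, `dim Q(f) = 3` of `⟨|Jf|²⟩ + f*(E_n) = R_f` for `g(x) = x³/3`.) -/
theorem ramification_eq_case_cusp_dim_one
    (φ : ℝ → ℝ) (hφ : ContDiff ℝ ∞ φ)
    (U : Set ℝ) (hU : U ∈ nhds (0 : ℝ))
    (a : ℝ → ℝ) (ha : ContDiff ℝ ∞ a)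
    (hda : ∀ x ∈ U, deriv φ x = a x * x ^ 2) :
    ∃ (V : Set ℝ) (μ η : ℝ → ℝ),
      V ∈ nhds (0 : ℝ) ∧ ContDiff ℝ ∞ μ ∧ ContDiff ℝ ∞ η ∧
      ∀ x ∈ V, φ x = μ x * x ^ 4 + η (x ^ 3 / 3) := by
  obtain ⟨r, hr, hrU⟩ := Metric.mem_nhds_iff.1 hU
  have hda' : ContDiff ℝ ∞ (deriv a) := (contDiff_infty_iff_deriv.1 ha).2
  set b : ℝ → ℝ := fun x => ∫ t in (0 : ℝ)..1, t ^ 0 * deriv a (t * x)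
  have hb : ContDiff ℝ ∞ b := contDiff_integral_pow_mul_comp_mul hda' 0
  have hab : ∀ x ∈ Metric.ball (0 : ℝ) r, a x = a 0 + x * b x := fun x hx => by
    rw [eq_add_pow_mul_integral_of_hasDerivAt (k := 0) hda'.continuous
      (fun y _ => (ha.differentiable (by simp) y).hasDerivAt.congr_deriv (by simp)) hx,
      zero_add, pow_one]
  refine ⟨Metric.ball 0 r, fun x => ∫ t in (0 : ℝ)..1, t ^ 3 * b (t * x),
    fun y => φ 0 + a 0 * y, Metric.ball_mem_nhds 0 hr,
    contDiff_integral_pow_mul_comp_mul hb 3, by fun_prop, fun x hx => ?_⟩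
  have hψ : ∀ y ∈ Metric.ball (0 : ℝ) r,
      HasDerivAt (fun y => φ y - a 0 * (y ^ 3 / 3)) (y ^ 3 * b y) y := fun y hy => by
    have hd := (hφ.differentiable (by simp) y).hasDerivAt.sub
      (((hasDerivAt_pow 3 y).div_const 3).const_mul (a 0))
    rw [hda y (hrU hy), hab y hy] at hd
    refine hd.congr_deriv ?_
    push_cast
    ring
  have h := eq_add_pow_mul_integral_of_hasDerivAt hb.continuous hψ hx
  norm_num at h
  linarith
end
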